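/- Let N_R > 0, N_s > 1 and γ > 0 be real numbers. For η > 0 define I*(η, γ) = inf { sup_{t₁ < 1/2, t₂ < 1/2} [ t₁ u + t₂ v − η t₁/(1 − 2t₁) + N_R·log(1 − 2t₁) + N_R(N_s − 1)·log(1 − 2t₂) ] : u > 0, v > 0, u ≤ γ v }. If 0 < η₁ < η₂ and γ < (2N_R + η₁)/(2N_R(N_s − 1)), then I*(η₁, γ) < I*(η₂, γ). -/

import Mathlib

/-- The large-deviations rate function `I*(η,γ)` of Proposition 3. -/
noncomputable def rateFn (NR Ns γ η : ℝ) : ℝ :=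
  sInf {y : ℝ | ∃ u v : ℝ, 0 < u ∧ 0 < v ∧ u ≤ γ * v ∧
    y = sSup {x : ℝ | ∃ t₁ t₂ : ℝ, t₁ < 1 / 2 ∧ t₂ < 1 / 2 ∧
      x = t₁ * u + t₂ * v - η * t₁ / (1 - 2 * t₁) + NR * Real.log (1 - 2 * t₁)
        + NR * (Ns - 1) * Real.log (1 - 2 * t₂)}}

theorem Real.log_le_log_add_div_sub_one {x a : ℝ} (hx : 0 < x) (ha : 0 < a) :
    Real.log x ≤ Real.log a + (x / a - 1) := by
  have h := Real.log_le_sub_one_of_pos (div_pos hx ha)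
  rw [Real.log_div hx.ne' ha.ne'] at h
  linarith

/-- The exponent whose supremum over `t₁, t₂ < 1 / 2` is taken in `rateFn` is bounded above. -/
theorem bddAbove_rateFn_exponents {NR Ns η u v : ℝ} (hNR : 0 < NR) (hNs : 1 < Ns) (hη : 0 ≤ η)
    (hu : 0 < u) (hv : 0 < v) :
    BddAbove {x : ℝ | ∃ t₁ t₂ : ℝ, t₁ < 1 / 2 ∧ t₂ < 1 / 2 ∧
      x = t₁ * u + t₂ * v - η * t₁ / (1 - 2 * t₁) + NR * Real.log (1 - 2 * t₁)
        + NR * (Ns - 1) * Real.log (1 - 2 * t₂)} := by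
  have hM : 0 < NR * (Ns - 1) := mul_pos hNR (by linarith)
  generalize NR * (Ns - 1) = M at hM
  refine ⟨u / 2 + v / 2 + η / 2 + NR * (Real.log (2 * NR / u) - 1)
    + M * (Real.log (2 * M / v) - 1), ?_⟩
  rintro x ⟨t₁, t₂, h₁, h₂, rfl⟩
  have hs : 0 < 1 - 2 * t₁ := by linarith
  have hr : 0 < 1 - 2 * t₂ := by linarith
  have e₁ : NR * Real.log (1 - 2 * t₁) ≤
      NR * (Real.log (2 * NR / u) - 1) + (1 - 2 * t₁) * u / 2 := by
    calc _ ≤ NR * (Real.log (2 * NR / u) + ((1 - 2 * t₁) / (2 * NR / u) - 1)) := by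
          gcongr
          exact Real.log_le_log_add_div_sub_one hs (by positivity)
      _ = _ := by field_simp; ring
  have e₂ : M * Real.log (1 - 2 * t₂) ≤
      M * (Real.log (2 * M / v) - 1) + (1 - 2 * t₂) * v / 2 := by
    calc _ ≤ M * (Real.log (2 * M / v) + ((1 - 2 * t₂) / (2 * M / v) - 1)) := by
          gcongr
          exact Real.log_le_log_add_div_sub_one hr (by positivity)
      _ = _ := by field_simp; ring
  have e₃ : -(η * t₁ / (1 - 2 * t₁)) ≤ η / 2 := by
    have h : η / 2 + η * t₁ / (1 - 2 * t₁) = η / (2 * (1 - 2 * t₁)) := by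
      field_simp; ring
    have : 0 ≤ η / (2 * (1 - 2 * t₁)) := by positivity
    linarith
  linarith

/-- Weak duality: each admissible multiplier of the constraint `u ≤ γ v` bounds every supremum
in the definition of `rateFn` from below. -/
theorem dual_le_sSup_rateFn_exponents {NR Ns γ η l u v : ℝ} (hNR : 0 < NR) (hNs : 1 < Ns)
    (hη : 0 ≤ η) (hl : 0 ≤ l) (hγl : 2 * (γ * l) < 1) (hu : 0 < u) (hv : 0 < v)
    (huv : u ≤ γ * v) :
    η * l / (1 + 2 * l) + NR * Real.log (1 + 2 * l)
        + NR * (Ns - 1) * Real.log (1 - 2 * (γ * l)) ≤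
      sSup {x : ℝ | ∃ t₁ t₂ : ℝ, t₁ < 1 / 2 ∧ t₂ < 1 / 2 ∧
        x = t₁ * u + t₂ * v - η * t₁ / (1 - 2 * t₁) + NR * Real.log (1 - 2 * t₁)
          + NR * (Ns - 1) * Real.log (1 - 2 * t₂)} := by
  refine le_trans ?_ (le_csSup (bddAbove_rateFn_exponents hNR hNs hη hu hv)
    ⟨-l, γ * l, by linarith, by linarith, rfl⟩)
  have e₁ : 1 - 2 * -l = 1 + 2 * l := by ring
  have e₂ : η * -l / (1 + 2 * l) = -(η * l / (1 + 2 * l)) := by ring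
  have e₃ : 0 ≤ l * (γ * v - u) := mul_nonneg hl (by linarith)
  rw [e₁, e₂]
  linarith

theorem dual_le_rateFn {NR Ns γ η l : ℝ} (hNR : 0 < NR) (hNs : 1 < Ns) (hγ : 0 < γ)
    (hη : 0 ≤ η) (hl : 0 ≤ l) (hγl : 2 * (γ * l) < 1) :
    η * l / (1 + 2 * l) + NR * Real.log (1 + 2 * l)
        + NR * (Ns - 1) * Real.log (1 - 2 * (γ * l)) ≤ rateFn NR Ns γ η := by
  refine le_csInf ⟨_, γ, 1, hγ, one_pos, by simp, rfl⟩ ?_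
  rintro y ⟨u, v, hu, hv, huv, rfl⟩
  exact dual_le_sSup_rateFn_exponents hNR hNs hη hl hγl hu hv huv

/-- Strong duality at a critical point of the dual function. -/
theorem rateFn_le_dual {NR Ns γ η l : ℝ} (hNR : 0 < NR) (hNs : 1 < Ns) (hγ : 0 < γ)
    (hη : 0 ≤ η) (hl : 0 ≤ l) (hγl : 2 * (γ * l) < 1)
    (hcrit : (η + 2 * NR * (1 + 2 * l)) * (1 - 2 * (γ * l)) =
      2 * (NR * (Ns - 1)) * γ * (1 + 2 * l) ^ 2) :
    rateFn NR Ns γ η ≤ η * l / (1 + 2 * l) + NR * Real.log (1 + 2 * l)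
        + NR * (Ns - 1) * Real.log (1 - 2 * (γ * l)) := by
  have hM : 0 < NR * (Ns - 1) := mul_pos hNR (by linarith)
  have ha : 0 < 1 + 2 * l := by linarith
  have hb : 0 < 1 - 2 * (γ * l) := by linarith
  have hbdd : BddBelow {y : ℝ | ∃ u v : ℝ, 0 < u ∧ 0 < v ∧ u ≤ γ * v ∧
      y = sSup {x : ℝ | ∃ t₁ t₂ : ℝ, t₁ < 1 / 2 ∧ t₂ < 1 / 2 ∧
        x = t₁ * u + t₂ * v - η * t₁ / (1 - 2 * t₁) + NR * Real.log (1 - 2 * t₁)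
          + NR * (Ns - 1) * Real.log (1 - 2 * t₂)}} := by
    refine ⟨η * l / (1 + 2 * l) + NR * Real.log (1 + 2 * l)
      + NR * (Ns - 1) * Real.log (1 - 2 * (γ * l)), ?_⟩
    rintro y ⟨u, v, hu, hv, huv, rfl⟩
    exact dual_le_sSup_rateFn_exponents hNR hNs hη hl hγl hu hv huv
  have hv : 0 < 2 * (NR * (Ns - 1)) / (1 - 2 * (γ * l)) := by positivity
  refine (csInf_le hbdd ⟨γ * (2 * (NR * (Ns - 1)) / (1 - 2 * (γ * l))),
    2 * (NR * (Ns - 1)) / (1 - 2 * (γ * l)), mul_pos hγ hv, hv, le_rfl, rfl⟩).trans ?_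
  refine csSup_le ⟨_, 0, 0, by norm_num, by norm_num, rfl⟩ ?_
  rintro x ⟨t₁, t₂, h₁, h₂, rfl⟩
  generalize NR * (Ns - 1) = M at *
  have hu : γ * (2 * M / (1 - 2 * (γ * l))) = η / (1 + 2 * l) ^ 2 + 2 * NR / (1 + 2 * l) := by
    rw [← mul_div_assoc, div_eq_iff hb.ne']
    field_simp
    linarith
  have hs : 0 < 1 - 2 * t₁ := by linarith
  have hr : 0 < 1 - 2 * t₂ := by linarith
  have e₁ := mul_le_mul_of_nonneg_left (Real.log_le_log_add_div_sub_one hs ha) hNR.le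
  have e₂ := mul_le_mul_of_nonneg_left (Real.log_le_log_add_div_sub_one hr hb) hM.le
  have e₃ : -(η * t₁ / (1 - 2 * t₁)) ≤
      η * l / (1 + 2 * l) - η * (t₁ + l) / (1 + 2 * l) ^ 2 := by
    have h : η * l / (1 + 2 * l) - η * (t₁ + l) / (1 + 2 * l) ^ 2 + η * t₁ / (1 - 2 * t₁)
        = 2 * η * (t₁ + l) ^ 2 / ((1 + 2 * l) ^ 2 * (1 - 2 * t₁)) := by
      field_simp; ring
    have : 0 ≤ 2 * η * (t₁ + l) ^ 2 / ((1 + 2 * l) ^ 2 * (1 - 2 * t₁)) := by positivity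
    linarith
  have e₄ : NR * ((1 - 2 * t₁) / (1 + 2 * l) - 1) = -(t₁ + l) * (2 * NR / (1 + 2 * l)) := by
    field_simp; ring
  have e₅ : M * ((1 - 2 * t₂) / (1 - 2 * (γ * l)) - 1)
      = -(t₂ - γ * l) * (2 * M / (1 - 2 * (γ * l))) := by
    rw [div_sub_one hb.ne']; ring
  have e₆ : (t₁ + l) * (γ * (2 * M / (1 - 2 * (γ * l)))) =
      η * (t₁ + l) / (1 + 2 * l) ^ 2 + (t₁ + l) * (2 * NR / (1 + 2 * l)) := by
    rw [hu]; ring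
  linarith

/-- Below the threshold on `γ`, the dual function has a positive critical point. -/
theorem exists_pos_dual_critical {NR M γ η : ℝ} (hM : 0 < M) (hγ : 0 < γ)
    (hth : 2 * M * γ < 2 * NR + η) :
    ∃ l : ℝ, 0 < l ∧ 2 * (γ * l) < 1 ∧
      (η + 2 * NR * (1 + 2 * l)) * (1 - 2 * (γ * l)) = 2 * M * γ * (1 + 2 * l) ^ 2 := by
  let g : ℝ → ℝ := fun l ↦
    (η + 2 * NR * (1 + 2 * l)) * (1 - 2 * (γ * l)) - 2 * M * γ * (1 + 2 * l) ^ 2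
  have hg : ContinuousOn g (Set.Icc 0 (1 / (2 * γ))) := by fun_prop
  have h0 : 0 < g 0 := by simp only [g]; linarith
  have h1 : g (1 / (2 * γ)) < 0 := by
    have h : 1 - 2 * (γ * (1 / (2 * γ))) = 0 := by field_simp; norm_num
    have : 0 < 2 * M * γ * (1 + 2 * (1 / (2 * γ))) ^ 2 := by positivity
    simp only [g, h]
    linarith
  obtain ⟨l, ⟨hl0, hl1⟩, hl⟩ := intermediate_value_Ioo' (by positivity) hg ⟨h1, h0⟩
  refine ⟨l, hl0, ?_, sub_eq_zero.mp hl⟩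
  rw [lt_div_iff₀ (by positivity)] at hl1
  linarith


/-- Monotonicity claim of Proposition 3: for `γ < (2N_R + η₁)/(2N_R(N_s−1))` and
`0 < η₁ < η₂`, the rate function is strictly increasing: `I*(η₁,γ) < I*(η₂,γ)`. -/
theorem stmt_14 (NR Ns γ : ℝ) (hNR : 0 < NR) (hNs : 1 < Ns) (hγ : 0 < γ)
    (η₁ η₂ : ℝ) (hη₁ : 0 < η₁) (hη : η₁ < η₂)
    (hth : γ < (2 * NR + η₁) / (2 * NR * (Ns - 1))) :
    rateFn NR Ns γ η₁ < rateFn NR Ns γ η₂ := by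
  have hM : 0 < NR * (Ns - 1) := mul_pos hNR (by linarith)
  rw [mul_assoc, lt_div_iff₀ (by positivity)] at hth
  obtain ⟨l, hl, hγl, hcrit⟩ :=
    exists_pos_dual_critical (NR := NR) (η := η₁) hM hγ (by linarith)
  calc rateFn NR Ns γ η₁ ≤ _ := rateFn_le_dual hNR hNs hγ hη₁.le hl.le hγl hcrit
    _ < η₂ * l / (1 + 2 * l) + NR * Real.log (1 + 2 * l)
        + NR * (Ns - 1) * Real.log (1 - 2 * (γ * l)) := by
      have : η₁ * l / (1 + 2 * l) < η₂ * l / (1 + 2 * l) := by gcongr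
      linarith
    _ ≤ rateFn NR Ns γ η₂ := dual_le_rateFn hNR hNs hγ (hη₁.trans hη).le hl.le hγl
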